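/- If q ≥ n, then F(n,q) = P₂(n,n); that is, every map f : Z₂ⁿ → Z₂ⁿ can be implemented by a reversible circuit with n+q inputs, consisting of gates from Ω_{n+q}², using q additional inputs. -/

import Mathlib

namespace RevCirc

/-- A reversible gate on `n` wires: a target coordinate together with a set of
at most two control coordinates not containing the target.  With no controls it
is a NOT gate, with one control a CNOT gate and with two controls a 2-CNOT
(Toffoli) gate. -/
abbrev Gate (n : ℕ) : Type :=
  {p : Fin n × Finset (Fin n) // p.2.card ≤ 2 ∧ p.1 ∉ p.2}

def Gate.target {n : ℕ} (g : Gate n) : Fin n := g.1.1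

def Gate.controls {n : ℕ} (g : Gate n) : Finset (Fin n) := g.1.2

/-- The transformation of `ℤ₂ⁿ` defined by a gate: the target coordinate is
XOR-ed with the conjunction of the control coordinates. -/
def Gate.apply {n : ℕ} (g : Gate n) (x : Fin n → Bool) : Fin n → Bool :=
  fun i => if i = g.target then xor (x i) (decide (∀ j ∈ g.controls, x j = true)) else x i

/-- The transformation defined by a circuit (a list of gates, applied left to right). -/
def evalCircuit {n : ℕ} (c : List (Gate n)) (x : Fin n → Bool) : Fin n → Bool :=
  c.foldl (fun y g => g.apply y) x

/-- A circuit realizes a permutation `h` of `ℤ₂ⁿ` (without additional inputs) if the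
composition of its gates equals `h`. -/
def realizes {n : ℕ} (c : List (Gate n)) (h : Equiv.Perm (Fin n → Bool)) : Prop :=
  ∀ x, evalCircuit c x = h x

/-- The expanding function `ℤ₂ⁿ → ℤ₂^{n+q}` padding with zeros. -/
def expand (n q : ℕ) (x : Fin n → Bool) : Fin (n + q) → Bool :=
  fun i => if h : (i : ℕ) < n then x ⟨i, h⟩ else false

/-- A circuit with `n+q` inputs implements `f : ℤ₂ⁿ → ℤ₂ⁿ` using `q` additional
inputs if for some permutation `π` of the wires, the coordinates `π(1),…,π(n)` of the
output on the zero-padded input give `f`. -/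
def implements (n q : ℕ) (c : List (Gate (n + q)))
    (f : (Fin n → Bool) → (Fin n → Bool)) : Prop :=
  ∃ π : Equiv.Perm (Fin (n + q)), ∀ x : Fin n → Bool, ∀ i : Fin n,
    evalCircuit c (expand n q x) (π (Fin.castLE (Nat.le_add_right n q) i)) = f x i

/-- `F(n,q)`: the set of transformations `ℤ₂ⁿ → ℤ₂ⁿ` implementable by reversible
circuits with `n+q` inputs. -/
def FSet (n q : ℕ) : Set ((Fin n → Bool) → (Fin n → Bool)) :=
  {f | ∃ c : List (Gate (n + q)), implements n q c f}

/-- The set of wires touched by a gate: its target together with its controls. -/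
def Gate.support {n : ℕ} (g : Gate n) : Finset (Fin n) := insert g.target g.controls

/-- A circuit has depth 1 if the supports of its gates are pairwise disjoint. -/
def DepthOne {n : ℕ} (c : List (Gate n)) : Prop :=
  c.Pairwise fun g₁ g₂ => Disjoint g₁.support g₂.support

/-- The depth of a circuit: the minimal number of consecutive depth-1 sub-circuits
into which it can be divided. -/
noncomputable def depth {n : ℕ} (c : List (Gate n)) : ℕ :=
  sInf {d | ∃ parts : List (List (Gate n)),
    parts.flatten = c ∧ (∀ p ∈ parts, DepthOne p) ∧ parts.length = d}

/-- The quantum weight of a circuit: each NOT and CNOT gate weighs `WC`, each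
2-CNOT gate weighs `WT`. -/
def weight {n : ℕ} (WC WT : ℝ) (c : List (Gate n)) : ℝ :=
  (c.map fun g => if g.controls.card = 2 then WT else WC).sum

/-- `L(f,q)`: minimal gate complexity of a circuit implementing `f` with `q`
additional inputs. -/
noncomputable def Lmin (n q : ℕ) (f : (Fin n → Bool) → (Fin n → Bool)) : ℕ :=
  sInf {l | ∃ c : List (Gate (n + q)), implements n q c f ∧ c.length = l}

/-- The Shannon gate complexity function `L(n,q)`. -/
noncomputable def ShannonL (n q : ℕ) : ℕ := sSup (Lmin n q '' FSet n q)

/-- `D(f,q)`: minimal depth of a circuit implementing `f` with `q` additional inputs. -/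
noncomputable def Dmin (n q : ℕ) (f : (Fin n → Bool) → (Fin n → Bool)) : ℕ :=
  sInf {d | ∃ c : List (Gate (n + q)), implements n q c f ∧ depth c = d}

/-- The Shannon depth function `D(n,q)`. -/
noncomputable def ShannonD (n q : ℕ) : ℕ := sSup (Dmin n q '' FSet n q)

/-- `W(f,q)`: minimal quantum weight of a circuit implementing `f` with `q`
additional inputs. -/
noncomputable def Wmin (WC WT : ℝ) (n q : ℕ) (f : (Fin n → Bool) → (Fin n → Bool)) : ℝ :=
  sInf {w | ∃ c : List (Gate (n + q)), implements n q c f ∧ weight WC WT c = w}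

/-- The Shannon quantum weight function `W(n,q)`. -/
noncomputable def ShannonW (WC WT : ℝ) (n q : ℕ) : ℝ := sSup (Wmin WC WT n q '' FSet n q)

/-- A permutation is a product of `K` pairwise disjoint (independent) transpositions:
there are `2K` pairwise distinct points `x i, y i` with `g = (x 1, y 1)∘⋯∘(x K, y K)`. -/
def IsProdOfDisjointTranspositions {X : Type*} [DecidableEq X] (K : ℕ)
    (g : Equiv.Perm X) : Prop :=
  ∃ x y : Fin K → X,
    Function.Injective (Sum.elim x y) ∧
    g = ((List.finRange K).map fun i => Equiv.swap (x i) (y i)).prod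

end RevCirc


namespace RevCirc

/-- There is a circuit XOR-ing `φ` into wire `t`. -/
def XorReal {m : ℕ} (t : Fin m) (φ : (Fin m → Bool) → Bool) : Prop :=
  ∃ c : List (Gate m), ∀ x, evalCircuit c x = Function.update x t (xor (x t) (φ x))

theorem evalCircuit_append {m : ℕ} (c d : List (Gate m)) (x : Fin m → Bool) :
    evalCircuit (c ++ d) x = evalCircuit d (evalCircuit c x) := by
  simp [evalCircuit, List.foldl_append]

theorem xorReal_gate {m : ℕ} (t : Fin m) (S : Finset (Fin m)) (hS : S.card ≤ 2) (ht : t ∉ S) :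
    XorReal t (fun x => decide (∀ j ∈ S, x j = true)) := by
  refine ⟨[⟨(t, S), hS, ht⟩], fun x => ?_⟩
  funext i
  by_cases hi : i = t
  · subst hi
    simp [evalCircuit, Gate.apply, Gate.target, Gate.controls]
    congr
  · simp [evalCircuit, Gate.apply, Gate.target, Gate.controls, hi]

theorem XorReal.xor {m : ℕ} {t : Fin m} {φ ψ : (Fin m → Bool) → Bool}
    (h₁ : XorReal t φ) (h₂ : XorReal t ψ) (hψ : ∀ x v, ψ (Function.update x t v) = ψ x) :
    XorReal t (fun x => xor (φ x) (ψ x)) := by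
  obtain ⟨c, hc⟩ := h₁
  obtain ⟨d, hd⟩ := h₂
  refine ⟨c ++ d, fun x => ?_⟩
  rw [evalCircuit_append, hc, hd, hψ]
  simp

theorem XorReal.congr {m : ℕ} {t : Fin m} {φ ψ : (Fin m → Bool) → Bool}
    (h₁ : XorReal t φ) (h : ∀ x, φ x = ψ x) : XorReal t ψ := by
  rwa [← funext h]

theorem xorReal_false {m : ℕ} (t : Fin m) : XorReal t (fun _ => false) :=
  ⟨[], fun x => by simp [evalCircuit]⟩

theorem xorReal_lit {m : ℕ} (t b : Fin m) (hb : t ≠ b) (v : Bool) :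
    XorReal t (fun x => decide (x b = v)) := by
  have h1 := xorReal_gate t {b} (by simp) (by simpa using hb)
  have h0 := xorReal_gate t ∅ (by simp) (by simp)
  cases v
  · refine (h1.xor h0 (by simp)).congr fun x => ?_
    cases hx : x b <;> simp [hx]
  · exact h1.congr fun x => by simp

theorem xorReal_lit_and {m : ℕ} (t b w : Fin m) (hb : t ≠ b) (hw : t ≠ w) (v : Bool) :
    XorReal t (fun x => decide (x b = v) && x w) := by
  have h1 := xorReal_gate t {b, w} Finset.card_le_two (by simp [hb, hw])
  have h0 := xorReal_lit t w hw true
  cases v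
  · refine (h1.xor h0 (by simp [Function.update_of_ne hw.symm])).congr fun x => ?_
    cases hx : x b <;> cases hy : x w <;> simp [hx, hy]
  · refine h1.congr fun x => ?_
    cases hx : x b <;> cases hy : x w <;> simp [hx, hy]

theorem xorReal_cube {m : ℕ} (a : Fin m → Bool) (S : Finset (Fin m)) :
    ∀ t w : Fin m, t ∉ S → w ∉ S → t ≠ w →
      XorReal t (fun x => decide (∀ j ∈ S, x j = a j)) := by
  induction S using Finset.induction_on with
  | empty =>
    intro t w _ _ _
    exact (xorReal_gate t ∅ (by simp) (by simp)).congr fun x => by simp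
  | insert b A hbA ih =>
    intro t w ht hw htw
    simp only [Finset.mem_insert, not_or] at ht hw
    obtain ⟨c, hc⟩ := ih w t hw.2 ht.2 htw.symm
    obtain ⟨d, hd⟩ := xorReal_lit_and t b w ht.1 htw (a b)
    refine ⟨c ++ d ++ c ++ d, fun x => ?_⟩
    have key : ∀ (y : Fin m → Bool) (u : Fin m) (v : Bool), u ∉ A →
        decide (∀ j ∈ A, Function.update y u v j = a j) = decide (∀ j ∈ A, y j = a j) := by
      intro y u v hu
      refine decide_eq_decide.2 (forall₂_congr fun j hj => ?_)
      rw [Function.update_of_ne (by rintro rfl; exact hu hj)]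
    simp only [evalCircuit_append, hc, hd, key _ _ _ hw.2, key _ _ _ ht.2]
    funext i
    have e : decide (∀ j ∈ insert b A, x j = a j) =
      (decide (x b = a b) && decide (∀ j ∈ A, x j = a j)) := by
      rw [Bool.eq_iff_iff]; simp
    rw [e]
    generalize decide (∀ j ∈ A, x j = a j) = P
    by_cases hit : i = t
    · subst hit
      simp [Function.update_of_ne ht.1, Function.update_of_ne (Ne.symm ht.1),
        Function.update_of_ne (Ne.symm hw.1), Function.update_of_ne htw,
        Function.update_of_ne htw.symm]
      cases decide (x b = a b) <;> cases P <;> cases x w <;> cases x i <;> rfl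
    · by_cases hiw : i = w
      · subst hiw
        simp [hit]
      · simp [hit, hiw]

/-- Reading the first `n` wires. -/
def readIn (n q : ℕ) (y : Fin (n + q) → Bool) : Fin n → Bool := fun i => y (Fin.castAdd q i)

theorem readIn_update {n q : ℕ} (y : Fin (n + q) → Bool) (j : Fin q) (v : Bool) :
    readIn n q (Function.update y (Fin.natAdd n j) v) = readIn n q y := by
  funext i
  simp only [readIn]
  rw [Function.update_of_ne]
  intro h
  have := congrArg Fin.val h
  simp at this
  omega

theorem xorReal_point {n q : ℕ} (h : n ≤ q) (hn : 0 < n) (j : Fin q) (a : Fin n → Bool) :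
    XorReal (Fin.natAdd n j) (fun y => decide (readIn n q y = a)) := by
  have hne : ∀ (j : Fin q) (i : Fin n), Fin.natAdd n j ≠ Fin.castAdd q i := by
    intro j i h
    have := congrArg Fin.val h
    simp at this
    omega
  obtain rfl | h2 : n = 1 ∨ 2 ≤ n := by omega
  · refine (xorReal_lit (Fin.natAdd 1 j) (Fin.castAdd q 0) (hne j 0) (a 0)).congr fun x => ?_
    refine decide_eq_decide.2 ?_
    simp [readIn, funext_iff]
  · obtain ⟨w, hw⟩ : ∃ w : Fin q, j ≠ w := by
      have : Nontrivial (Fin q) := Fin.nontrivial_iff_two_le.2 (by omega)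
      obtain ⟨w, hw⟩ := exists_ne j
      exact ⟨w, hw.symm⟩
    refine (xorReal_cube (Fin.append a (fun _ => false))
      (Finset.univ.image (Fin.castAdd q)) (Fin.natAdd n j) (Fin.natAdd n w)
      (by simpa using fun i => (hne j i).symm) (by simpa using fun i => (hne w i).symm)
      (by simpa using hw)).congr fun x => ?_
    refine decide_eq_decide.2 ?_
    simp [readIn, funext_iff]

theorem xorReal_fun {n q : ℕ} (h : n ≤ q) (hn : 0 < n) (j : Fin q) (φ : (Fin n → Bool) → Bool) :
    XorReal (Fin.natAdd n j) (fun y => φ (readIn n q y)) := by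
  have main : ∀ T : Finset (Fin n → Bool),
      XorReal (Fin.natAdd n j) (fun y => decide (readIn n q y ∈ T)) := by
    intro T
    induction T using Finset.induction_on with
    | empty => exact (xorReal_false _).congr fun x => by simp
    | insert a T ha ih =>
      refine (ih.xor (xorReal_point h hn j a) fun x v => by rw [readIn_update]).congr fun x => ?_
      by_cases hx : readIn n q x = a
      · simp [hx, ha]
      · simp [hx]
  exact (main (Finset.univ.filter fun a => φ a = true)).congr fun x => by simp

theorem exists_circuit {n q : ℕ} (h : n ≤ q) (hn : 0 < n) (f : (Fin n → Bool) → (Fin n → Bool))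
    (k : ℕ) (hk : k ≤ n) : ∃ c : List (Gate (n + q)), ∀ x,
      evalCircuit c (expand n q x) = Fin.append x
        (fun j : Fin q => if hj : (j : ℕ) < k then f x ⟨j, by omega⟩ else false) := by
  induction k with
  | zero =>
    refine ⟨[], fun x => ?_⟩
    funext i
    refine Fin.addCases (fun i => ?_) (fun i => ?_) i <;> simp [evalCircuit, expand]
  | succ k ih =>
    obtain ⟨c, hc⟩ := ih (by omega)
    obtain ⟨d, hd⟩ := xorReal_fun h hn ⟨k, by omega⟩ (fun x => f x ⟨k, by omega⟩)
    refine ⟨c ++ d, fun x => ?_⟩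
    rw [evalCircuit_append, hc, hd]
    have hr : ∀ z : Fin q → Bool, readIn n q (Fin.append x z) = x := by
      intro z; funext i; simp [readIn]
    beta_reduce
    rw [hr]
    funext i
    refine Fin.addCases (fun i => ?_) (fun i => ?_) i
    · rw [Function.update_of_ne]
      · simp
      · intro h
        have := congrArg Fin.val h
        simp at this
        omega
    · by_cases hi : i = ⟨k, by omega⟩
      · subst hi
        rw [Function.update_self, Fin.append_right, Fin.append_right]
        simp
      · have hik : (i : ℕ) ≠ k := fun h' => hi (Fin.ext h')
        rw [Function.update_of_ne (fun h' => hik (by simpa using congrArg Fin.val h'))]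
        have : ((i : ℕ) < k) ↔ (i : ℕ) < k + 1 := by omega
        simp [this]

theorem exists_perm {n q : ℕ} (h : n ≤ q) : ∃ π : Equiv.Perm (Fin (n + q)),
    ∀ i : Fin n, π (Fin.castLE (Nat.le_add_right n q) i) = Fin.natAdd n (Fin.castLE h i) := by
  let g : Fin (n + q) → Fin (n + q) := fun i =>
    if h1 : (i : ℕ) < n then ⟨n + i, by omega⟩
    else if h2 : (i : ℕ) < n + n then ⟨i - n, by omega⟩ else i
  have hg : Function.Involutive g := by
    intro i
    have hi := i.isLt
    by_cases h1 : (i : ℕ) < n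
    · apply Fin.ext
      simp [g, h1]
    · by_cases h2 : (i : ℕ) < n + n
      · have h3 : (i : ℕ) - n < n := by omega
        apply Fin.ext
        simp only [g, h1, h2, h3, dif_pos, dif_neg, not_false_eq_true]
        omega
      · simp [g, h1, h2]
  refine ⟨hg.toPerm, fun i => ?_⟩
  apply Fin.ext
  simp [g]

end RevCirc

/-- Theorem: if `q ≥ n` then `F(n,q) = P₂(n,n)`, i.e. every map `ℤ₂ⁿ → ℤ₂ⁿ` can be
implemented by a reversible circuit with `n+q` inputs using `q` additional inputs. -/
theorem FSet_eq_univ_of_many_additional_inputs (n q : ℕ) (h : n ≤ q) :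
    RevCirc.FSet n q = Set.univ := by
  refine Set.eq_univ_of_forall fun f => ?_
  rcases Nat.eq_zero_or_pos n with rfl | hn
  · exact ⟨[], 1, fun x i => i.elim0⟩
  · obtain ⟨c, hc⟩ := RevCirc.exists_circuit h hn f n le_rfl
    obtain ⟨π, hπ⟩ := RevCirc.exists_perm h
    refine ⟨c, π, fun x i => ?_⟩
    rw [hπ, hc]
    simp
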